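/- arXiv:2402.09306 — 6 statements merged into one kernel-verified Lean document; each statement's English description precedes it below -/
import Mathlib

section
/- Let n ≥ 1, let Ω be a nonempty bounded open subset of EuclideanSpace ℝ n, and let u be continuous on the closure of Ω. Let U₁ and U₂ be two classical solutions of the Poisson–Boltzmann equation with homogeneous Dirichlet boundary conditions associated with the same external potential u, and set Iᵢ = ∫_Ω exp(-(u(x)+Uᵢ(x))) dx for i = 1, 2. If I₁ ≥ I₂, then U₁(x) ≤ U₂(x) for every x ∈ Ω; in particular, if I₁ = I₂ then U₁(x) = U₂(x) for every x ∈ Ω. -/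
open MeasureTheory Real

/-- The normalized Boltzmann density `Φ(W,u)(x) = exp(-(u(x)+W(x))) / ∫_Ω exp(-(u(y)+W(y))) dy`. -/
noncomputable def PhiPB {n : ℕ} (Ω : Set (EuclideanSpace ℝ (Fin n)))
    (u W : EuclideanSpace ℝ (Fin n) → ℝ) (x : EuclideanSpace ℝ (Fin n)) : ℝ :=
  Real.exp (-(u x + W x)) / ∫ y in Ω, Real.exp (-(u y + W y))

/-- The Laplacian of a real-valued function on Euclidean space,
`Δf(x) = ∑ i ∂²f/∂xᵢ²(x)`. -/
noncomputable def laplacianPB {n : ℕ} (f : EuclideanSpace ℝ (Fin n) → ℝ)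
    (x : EuclideanSpace ℝ (Fin n)) : ℝ :=
  ∑ i : Fin n,
    fderiv ℝ (fun y => fderiv ℝ f y (EuclideanSpace.single i 1)) x (EuclideanSpace.single i 1)

/-- A classical solution of the Poisson–Boltzmann equation with homogeneous Dirichlet
boundary conditions on `Ω`, associated with the external potential `u`. -/
structure IsClassicalSolutionPB {n : ℕ} (Ω : Set (EuclideanSpace ℝ (Fin n)))
    (u U : EuclideanSpace ℝ (Fin n) → ℝ) : Prop where
  contOn : ContinuousOn U (closure Ω)
  smooth : ContDiffOn ℝ 2 U Ω
  boundary : ∀ x ∈ frontier Ω, U x = 0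
  intPos : 0 < ∫ y in Ω, Real.exp (-(u y + U y))
  eqn : ∀ x ∈ Ω, -laplacianPB U x = PhiPB Ω u U x

/-- The second derivative of a function of one variable is nonpositive at a local maximum. -/
theorem deriv_deriv_nonpos_of_isLocalMax {g : ℝ → ℝ} {a : ℝ} (hg : ContinuousAt g a)
    (h : IsLocalMax g a) : deriv (deriv g) a ≤ 0 := by
  by_contra! hpos
  have hmin : IsLocalMin g a := isLocalMin_of_deriv_deriv_pos hpos h.deriv_eq_zero hg
  have hconst : g =ᶠ[nhds a] fun _ => g a := by
    filter_upwards [h, hmin] with y hy hy'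
    exact le_antisymm hy hy'
  have hzero : deriv (deriv g) a = 0 := by
    rw [hconst.deriv.deriv_eq]
    simp
  exact hpos.ne' hzero

/-- The second derivative in any direction is nonpositive at an interior local maximum. -/
theorem fderiv_fderiv_apply_nonpos_of_isLocalMax {E : Type*} [NormedAddCommGroup E]
    [NormedSpace ℝ E] {f : E → ℝ} {x : E} (hf : ContDiffAt ℝ 2 f x) (h : IsLocalMax f x) (v : E) :
    fderiv ℝ (fun y => fderiv ℝ f y v) x v ≤ 0 := by
  have hline : ∀ t : ℝ, HasDerivAt (fun s : ℝ => x + s • v) v t := fun t => by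
    simpa using ((hasDerivAt_id t).smul_const v).const_add x
  have htend : Filter.Tendsto (fun s : ℝ => x + s • v) (nhds 0) (nhds x) := by
    simpa [ContinuousAt] using (hline 0).continuousAt
  have hdiff : ∀ᶠ y in nhds x, DifferentiableAt ℝ f y :=
    (hf.eventually (by simp)).mono fun y hy => hy.differentiableAt (by simp)
  have hderiv : deriv (fun s : ℝ => f (x + s • v)) =ᶠ[nhds 0]
      fun s => fderiv ℝ f (x + s • v) v := by
    filter_upwards [htend.eventually hdiff] with s hs
    exact (hs.hasFDerivAt.comp_hasDerivAt s (hline s)).deriv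
  have hdir : DifferentiableAt ℝ (fun y => fderiv ℝ f y v) x :=
    ((hf.fderiv_right (m := 1) (by norm_num)).differentiableAt (by simp)).clm_apply
      (differentiableAt_const v)
  have hsecond : deriv (fun s : ℝ => fderiv ℝ f (x + s • v) v) 0 =
      fderiv ℝ (fun y => fderiv ℝ f y v) x v := by
    have hdir' : HasFDerivAt (fun y => fderiv ℝ f y v) (fderiv ℝ (fun y => fderiv ℝ f y v) x)
        (x + (0 : ℝ) • v) := by simpa using hdir.hasFDerivAt
    exact (hdir'.comp_hasDerivAt 0 (hline 0)).deriv
  rw [← hsecond, ← hderiv.deriv_eq]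
  refine deriv_deriv_nonpos_of_isLocalMax ?_ ?_
  · have hc : ContinuousAt f (x + (0 : ℝ) • v) := by simpa using hf.continuousAt
    exact ContinuousAt.comp (f := fun s : ℝ => x + s • v) hc (hline 0).continuousAt
  · have := htend.eventually h
    simpa [IsLocalMax, IsMaxFilter] using this

theorem laplacianPB_nonpos_of_isLocalMax {n : ℕ} {f : EuclideanSpace ℝ (Fin n) → ℝ}
    {x : EuclideanSpace ℝ (Fin n)} (hf : ContDiffAt ℝ 2 f x) (h : IsLocalMax f x) :
    laplacianPB f x ≤ 0 :=
  Finset.sum_nonpos fun _ _ => fderiv_fderiv_apply_nonpos_of_isLocalMax hf h _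

theorem laplacianPB_sub {n : ℕ} {f g : EuclideanSpace ℝ (Fin n) → ℝ}
    {x : EuclideanSpace ℝ (Fin n)} (hf : ContDiffAt ℝ 2 f x) (hg : ContDiffAt ℝ 2 g x) :
    laplacianPB (fun y => f y - g y) x = laplacianPB f x - laplacianPB g x := by
  unfold laplacianPB
  rw [← Finset.sum_sub_distrib]
  refine Finset.sum_congr rfl fun i _ => ?_
  have hdir : ∀ {k : EuclideanSpace ℝ (Fin n) → ℝ}, ContDiffAt ℝ 2 k x →
      DifferentiableAt ℝ (fun y => fderiv ℝ k y (EuclideanSpace.single i 1)) x := fun hk =>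
    ((hk.fderiv_right (m := 1) (by norm_num)).differentiableAt (by simp)).clm_apply
      (differentiableAt_const _)
  have heq : (fun y => fderiv ℝ (fun z => f z - g z) y (EuclideanSpace.single i 1)) =ᶠ[nhds x]
      fun y => fderiv ℝ f y (EuclideanSpace.single i 1) -
        fderiv ℝ g y (EuclideanSpace.single i 1) := by
    filter_upwards [hf.eventually (by simp), hg.eventually (by simp)] with y hfy hgy
    rw [fderiv_fun_sub (hfy.differentiableAt (by simp)) (hgy.differentiableAt (by simp))]
    rfl
  rw [heq.fderiv_eq, fderiv_fun_sub (hdir hf) (hdir hg)]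
  rfl

/-- Solutions are ordered oppositely to their normalization integrals. -/
theorem IsClassicalSolutionPB.le_of_integral_le {n : ℕ} {Ω : Set (EuclideanSpace ℝ (Fin n))}
    (hΩo : IsOpen Ω) (hΩb : Bornology.IsBounded Ω) {u U₁ U₂ : EuclideanSpace ℝ (Fin n) → ℝ}
    (h₁ : IsClassicalSolutionPB Ω u U₁) (h₂ : IsClassicalSolutionPB Ω u U₂)
    (hI : (∫ y in Ω, Real.exp (-(u y + U₂ y))) ≤ ∫ y in Ω, Real.exp (-(u y + U₁ y)))
    {x : EuclideanSpace ℝ (Fin n)} (hx : x ∈ Ω) : U₁ x ≤ U₂ x := by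
  obtain ⟨x₀, hx₀, hmax⟩ := hΩb.isCompact_closure.exists_isMaxOn ⟨x, subset_closure hx⟩
    (h₁.contOn.sub h₂.contOn)
  by_contra! hlt
  have hle : U₁ x - U₂ x ≤ U₁ x₀ - U₂ x₀ := hmax (subset_closure hx)
  have hpos : U₂ x₀ < U₁ x₀ := by linarith
  have hmem : x₀ ∈ Ω := by
    by_contra hnot
    have hfr : x₀ ∈ frontier Ω := by
      rw [hΩo.frontier_eq]
      exact ⟨hx₀, hnot⟩
    linarith [h₁.boundary x₀ hfr, h₂.boundary x₀ hfr]
  have hnhds : Ω ∈ nhds x₀ := hΩo.mem_nhds hmem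
  have hc₁ := h₁.smooth.contDiffAt hnhds
  have hc₂ := h₂.smooth.contDiffAt hnhds
  have hlap := laplacianPB_nonpos_of_isLocalMax (hc₁.sub hc₂)
    (hmax.isLocalMax (Filter.mem_of_superset hnhds subset_closure))
  have hsub := laplacianPB_sub hc₁ hc₂
  have hΦ : PhiPB Ω u U₁ x₀ < PhiPB Ω u U₂ x₀ :=
    div_lt_div₀ (Real.exp_lt_exp.mpr (by linarith)) hI (Real.exp_pos _).le h₂.intPos
  have hlap' : laplacianPB (fun y => U₁ y - U₂ y) x₀ ≤ 0 := hlap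
  linarith [h₁.eqn x₀ hmem, h₂.eqn x₀ hmem]


/-- Comparison lemma for classical solutions of the Poisson–Boltzmann
equation: if `I₁ = ∫_Ω e^{-(u+U₁)} ≥ I₂ = ∫_Ω e^{-(u+U₂)}`, then `U₁ ≤ U₂` on `Ω`;
in particular if `I₁ = I₂` then `U₁ = U₂` on `Ω`. -/
theorem poissonBoltzmann_comparison {n : ℕ} (hn : 1 ≤ n)
    (Ω : Set (EuclideanSpace ℝ (Fin n))) (hΩne : Ω.Nonempty) (hΩo : IsOpen Ω)
    (hΩb : Bornology.IsBounded Ω)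
    (u U₁ U₂ : EuclideanSpace ℝ (Fin n) → ℝ) (hu : ContinuousOn u (closure Ω))
    (h₁ : IsClassicalSolutionPB Ω u U₁) (h₂ : IsClassicalSolutionPB Ω u U₂)
    (hI : (∫ y in Ω, Real.exp (-(u y + U₂ y))) ≤ ∫ y in Ω, Real.exp (-(u y + U₁ y))) :
    (∀ x ∈ Ω, U₁ x ≤ U₂ x) ∧
      ((∫ y in Ω, Real.exp (-(u y + U₁ y))) = (∫ y in Ω, Real.exp (-(u y + U₂ y))) →
        ∀ x ∈ Ω, U₁ x = U₂ x) := by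
  exact ⟨fun x hx => h₁.le_of_integral_le hΩo hΩb h₂ hI hx, fun hEq x hx =>
    le_antisymm (h₁.le_of_integral_le hΩo hΩb h₂ hI hx)
      (h₂.le_of_integral_le hΩo hΩb h₁ hEq.le hx)⟩
end

section
/- Let n ≥ 1, let Ω be a nonempty bounded open subset of EuclideanSpace ℝ n, and let u be continuous on the closure of Ω. Then the Poisson–Boltzmann equation with homogeneous Dirichlet boundary conditions has at most one classical solution: if U₁ and U₂ are classical solutions associated with the same external potential u, then U₁(x) = U₂(x) for every x in the closure of Ω. -/
open MeasureTheory Real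

theorem IsLocalMin.deriv_deriv_nonneg {g : ℝ → ℝ} {t : ℝ} (hg : ContinuousAt g t)
    (hmin : IsLocalMin g t) : 0 ≤ deriv (deriv g) t := by
  by_contra! hneg
  have hmax := isLocalMax_of_deriv_deriv_neg hneg hmin.deriv_eq_zero hg
  have hconst : g =ᶠ[nhds t] fun _ => g t := by
    filter_upwards [hmin, hmax] with s h₁ h₂ using le_antisymm h₂ h₁
  have hzero : deriv (deriv g) t = 0 := by
    rw [hconst.deriv.deriv_eq]
    simp
  exact hneg.ne hzero

theorem deriv_deriv_line_eq {E : Type*} [NormedAddCommGroup E] [NormedSpace ℝ E]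
    {f : E → ℝ} {x : E} (hf : ContDiffAt ℝ 2 f x) (v : E) :
    deriv (deriv fun t : ℝ => f (x + t • v)) 0 =
      fderiv ℝ (fun y => fderiv ℝ f y v) x v := by
  have hline (t : ℝ) : HasDerivAt (fun t : ℝ => x + t • v) v t := by
    simpa using ((hasDerivAt_id t).smul_const v).const_add x
  have hdiff : ∀ᶠ y in nhds x, DifferentiableAt ℝ f y := by
    filter_upwards [hf.eventually (by simp)] with y hy
    exact hy.differentiableAt (by norm_num)
  have htend : Filter.Tendsto (fun t : ℝ => x + t • v) (nhds 0) (nhds x) := by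
    simpa using (hline 0).continuousAt.tendsto
  have hderiv : deriv (fun t : ℝ => f (x + t • v)) =ᶠ[nhds 0]
      fun t => fderiv ℝ f (x + t • v) v := by
    filter_upwards [htend.eventually hdiff] with t ht
    exact (ht.hasFDerivAt.comp_hasDerivAt t (hline t)).deriv
  have hdd : DifferentiableAt ℝ (fun y => fderiv ℝ f y v) x :=
    ((hf.fderiv_right (m := 1) (by norm_num)).differentiableAt (by norm_num)).clm_apply
      (differentiableAt_const v)
  rw [hderiv.deriv_eq]
  have h₀ : HasFDerivAt (fun y => fderiv ℝ f y v)
      (fderiv ℝ (fun y => fderiv ℝ f y v) x) (x + (0 : ℝ) • v) := by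
    simpa using hdd.hasFDerivAt
  exact (h₀.comp_hasDerivAt 0 (hline 0)).deriv

theorem laplacianPB_nonneg_of_isLocalMin {n : ℕ} {f : EuclideanSpace ℝ (Fin n) → ℝ}
    {x : EuclideanSpace ℝ (Fin n)} (hf : ContDiffAt ℝ 2 f x) (hmin : IsLocalMin f x) :
    0 ≤ laplacianPB f x := by
  refine Finset.sum_nonneg fun i _ => ?_
  rw [← deriv_deriv_line_eq hf]
  have hline : ContinuousAt
      (fun t : ℝ => x + t • (EuclideanSpace.single i 1 : EuclideanSpace ℝ (Fin n))) 0 := by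
    fun_prop
  have htend : Filter.Tendsto
      (fun t : ℝ => x + t • (EuclideanSpace.single i 1 : EuclideanSpace ℝ (Fin n)))
      (nhds 0) (nhds x) := by
    simpa using hline.tendsto
  refine IsLocalMin.deriv_deriv_nonneg ?_ ?_
  · exact ContinuousAt.comp (g := f) (by simpa using hf.continuousAt) hline
  · filter_upwards [htend.eventually hmin] with t ht
    simpa using ht

namespace IsClassicalSolutionPB

variable {n : ℕ} {Ω : Set (EuclideanSpace ℝ (Fin n))}
  {u U U₁ U₂ : EuclideanSpace ℝ (Fin n) → ℝ}

theorem phiPB_eq_exp (h : IsClassicalSolutionPB Ω u U) (x : EuclideanSpace ℝ (Fin n)) :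
    PhiPB Ω u U x =
      Real.exp (-(u x + U x + Real.log (∫ y in Ω, Real.exp (-(u y + U y))))) := by
  rw [PhiPB, neg_add (u x + U x), Real.exp_add, Real.exp_neg (Real.log _),
    Real.exp_log h.intPos, div_eq_mul_inv]

theorem continuousOn_phiPB (h : IsClassicalSolutionPB Ω u U) (hu : ContinuousOn u (closure Ω)) :
    ContinuousOn (PhiPB Ω u U) (closure Ω) :=
  ((hu.add h.contOn).neg.rexp).div_const _

theorem integrableOn_phiPB (h : IsClassicalSolutionPB Ω u U) (hΩb : Bornology.IsBounded Ω)
    (hu : ContinuousOn u (closure Ω)) : IntegrableOn (PhiPB Ω u U) Ω :=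
  ((h.continuousOn_phiPB hu).integrableOn_compact hΩb.isCompact_closure).mono_set subset_closure

theorem integral_phiPB (h : IsClassicalSolutionPB Ω u U) : ∫ x in Ω, PhiPB Ω u U x = 1 := by
  simp only [PhiPB, integral_div]
  exact div_self h.intPos.ne'

theorem add_log_le_add_log (hΩo : IsOpen Ω) (hΩb : Bornology.IsBounded Ω)
    (h₁ : IsClassicalSolutionPB Ω u U₁) (h₂ : IsClassicalSolutionPB Ω u U₂)
    (hZ : ∫ y in Ω, Real.exp (-(u y + U₂ y)) ≤ ∫ y in Ω, Real.exp (-(u y + U₁ y)))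
    {x : EuclideanSpace ℝ (Fin n)} (hx : x ∈ closure Ω) :
    U₂ x + Real.log (∫ y in Ω, Real.exp (-(u y + U₂ y))) ≤
      U₁ x + Real.log (∫ y in Ω, Real.exp (-(u y + U₁ y))) := by
  obtain ⟨z, hz, hmin⟩ := hΩb.isCompact_closure.exists_isMinOn ⟨x, hx⟩
    (h₁.contOn.sub h₂.contOn)
  have hzx : U₁ z - U₂ z ≤ U₁ x - U₂ x := hmin hx
  have hlog := Real.log_le_log h₂.intPos hZ
  by_contra! hneg
  have hzΩ : z ∈ Ω := by
    by_contra hzn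
    have hzf : z ∈ frontier Ω := by
      rw [hΩo.frontier_eq]
      exact ⟨hz, hzn⟩
    have e₁ := h₁.boundary z hzf
    have e₂ := h₂.boundary z hzf
    linarith
  have hnhds := hΩo.mem_nhds hzΩ
  have d₁ := h₁.smooth.contDiffAt hnhds
  have d₂ := h₂.smooth.contDiffAt hnhds
  have hloc : IsLocalMin (fun y => U₁ y - U₂ y) z := by
    filter_upwards [hnhds] with y hy using hmin (subset_closure hy)
  have hlap := laplacianPB_nonneg_of_isLocalMin (d₁.sub d₂) hloc
  rw [laplacianPB_sub d₁ d₂] at hlap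
  have hlt : PhiPB Ω u U₂ z < PhiPB Ω u U₁ z := by
    rw [h₁.phiPB_eq_exp, h₂.phiPB_eq_exp]
    exact Real.exp_lt_exp.mpr (by linarith)
  linarith [h₁.eqn z hzΩ, h₂.eqn z hzΩ]

theorem eqOn_of_integral_le (hn : 1 ≤ n) (hΩne : Ω.Nonempty) (hΩo : IsOpen Ω)
    (hΩb : Bornology.IsBounded Ω) (hu : ContinuousOn u (closure Ω))
    (h₁ : IsClassicalSolutionPB Ω u U₁) (h₂ : IsClassicalSolutionPB Ω u U₂)
    (hZ : ∫ y in Ω, Real.exp (-(u y + U₂ y)) ≤ ∫ y in Ω, Real.exp (-(u y + U₁ y))) :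
    Set.EqOn U₁ U₂ (closure Ω) := by
  have hle : ∀ x ∈ Ω, PhiPB Ω u U₁ x ≤ PhiPB Ω u U₂ x := fun x hx => by
    rw [h₁.phiPB_eq_exp, h₂.phiPB_eq_exp]
    exact Real.exp_le_exp.mpr
      (by linarith [add_log_le_add_log hΩo hΩb h₁ h₂ hZ (subset_closure hx)])
  have hae : PhiPB Ω u U₁ =ᵐ[volume.restrict Ω] PhiPB Ω u U₂ :=
    (integral_eq_iff_of_ae_le (h₁.integrableOn_phiPB hΩb hu) (h₂.integrableOn_phiPB hΩb hu)
      (ae_restrict_of_forall_mem hΩo.measurableSet hle)).mp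
      (h₁.integral_phiPB.trans h₂.integral_phiPB.symm)
  have hΩeq : Set.EqOn (PhiPB Ω u U₁) (PhiPB Ω u U₂) Ω :=
    Measure.eqOn_open_of_ae_eq hae hΩo
      ((h₁.continuousOn_phiPB hu).mono subset_closure)
      ((h₂.continuousOn_phiPB hu).mono subset_closure)
  have heq : Set.EqOn (PhiPB Ω u U₁) (PhiPB Ω u U₂) (closure Ω) :=
    hΩeq.of_subset_closure (h₁.continuousOn_phiPB hu) (h₂.continuousOn_phiPB hu)
      subset_closure subset_rfl
  have hadd {x : EuclideanSpace ℝ (Fin n)} (hx : x ∈ closure Ω) :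
      U₁ x + Real.log (∫ y in Ω, Real.exp (-(u y + U₁ y))) =
        U₂ x + Real.log (∫ y in Ω, Real.exp (-(u y + U₂ y))) := by
    have h := heq hx
    rw [h₁.phiPB_eq_exp, h₂.phiPB_eq_exp, Real.exp_eq_exp] at h
    linarith
  have : Nonempty (Fin n) := ⟨⟨0, hn⟩⟩
  have hfr : (frontier Ω).Nonempty := by
    rw [nonempty_frontier_iff]
    refine ⟨hΩne, fun huniv => ?_⟩
    rw [huniv] at hΩb
    exact NormedSpace.unbounded_univ ℝ (EuclideanSpace ℝ (Fin n)) hΩb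
  obtain ⟨p, hp⟩ := hfr
  have hpadd := hadd (frontier_subset_closure hp)
  rw [h₁.boundary p hp, h₂.boundary p hp] at hpadd
  intro x hx
  linarith [hadd hx]

end IsClassicalSolutionPB

/-- The Poisson–Boltzmann equation with homogeneous Dirichlet boundary
conditions has at most one classical solution. -/
theorem poissonBoltzmann_uniqueness {n : ℕ} (hn : 1 ≤ n)
    (Ω : Set (EuclideanSpace ℝ (Fin n))) (hΩne : Ω.Nonempty) (hΩo : IsOpen Ω)
    (hΩb : Bornology.IsBounded Ω)
    (u U₁ U₂ : EuclideanSpace ℝ (Fin n) → ℝ) (hu : ContinuousOn u (closure Ω))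
    (h₁ : IsClassicalSolutionPB Ω u U₁) (h₂ : IsClassicalSolutionPB Ω u U₂) :
    ∀ x ∈ closure Ω, U₁ x = U₂ x := by
  rcases le_total (∫ y in Ω, Real.exp (-(u y + U₂ y)))
      (∫ y in Ω, Real.exp (-(u y + U₁ y))) with hZ | hZ
  · exact IsClassicalSolutionPB.eqOn_of_integral_le hn hΩne hΩo hΩb hu h₁ h₂ hZ
  · exact (IsClassicalSolutionPB.eqOn_of_integral_le hn hΩne hΩo hΩb hu h₂ h₁ hZ).symm
end

section
/- Let n ≥ 1 and let v : EuclideanSpace ℝ n → ℝ be twice continuously differentiable with compact support. Suppose there exists Ψ : EuclideanSpace ℝ n → ℝ with Ψ(x) ≥ -1/4 for all x, such that Δv(x) = Ψ(x)·v(x) for all x, where Δ denotes the Laplacian. If there exists a constant c with 0 ≤ c < 4 such that ∫ v(x)² dx ≤ c ∫ ‖∇v(x)‖² dx (a Poincaré inequality with constant c < 4, where ∇v denotes the gradient), then v is identically zero. -/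
open MeasureTheory Real

/-- Integration by parts in one direction for a compactly supported `C²` function. -/
theorem integral_fderiv_apply_sq_eq_neg {E : Type*} [NormedAddCommGroup E] [NormedSpace ℝ E]
    [FiniteDimensional ℝ E] [MeasurableSpace E] [BorelSpace E] {μ : Measure E}
    [μ.IsAddHaarMeasure] {f : E → ℝ} (hf : ContDiff ℝ 2 f) (hs : HasCompactSupport f) (e : E) :
    ∫ x, (fderiv ℝ f x e) ^ 2 ∂μ =
      -∫ x, f x * fderiv ℝ (fun y => fderiv ℝ f y e) x e ∂μ := by
  have hg : ContDiff ℝ 1 (fun y => fderiv ℝ f y e) :=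
    (hf.fderiv_right (by norm_num)).clm_apply contDiff_const
  have hgc : HasCompactSupport (fun y => fderiv ℝ f y e) := hs.fderiv_apply ℝ e
  have hg' : Continuous (fun x => fderiv ℝ (fun y => fderiv ℝ f y e) x e) :=
    (hg.continuous_fderiv (by norm_num)).clm_apply continuous_const
  rw [integral_mul_fderiv_eq_neg_fderiv_mul_of_integrable
    ((hg.continuous.mul hg.continuous).integrable_of_hasCompactSupport hgc.mul_right)
    ((hf.continuous.mul hg').integrable_of_hasCompactSupport hs.mul_right)
    ((hf.continuous.mul hg.continuous).integrable_of_hasCompactSupport hs.mul_right)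
    (fun x _ => hf.differentiable (by norm_num) x)
    (fun x _ => hg.differentiable (by norm_num) x), neg_neg]
  simp only [sq]

/-- The squared norm of the gradient is the sum of the squared partial derivatives. -/
theorem norm_gradient_sq_eq_sum {n : ℕ} (f : EuclideanSpace ℝ (Fin n) → ℝ)
    (x : EuclideanSpace ℝ (Fin n)) :
    ‖gradient f x‖ ^ 2 = ∑ i, (fderiv ℝ f x (EuclideanSpace.single i 1)) ^ 2 := by
  rw [EuclideanSpace.real_norm_sq_eq]
  refine Finset.sum_congr rfl fun i _ => ?_
  rw [← inner_gradient_left, EuclideanSpace.inner_single_right]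
  simp

/-- Green's identity: the Dirichlet energy of a compactly supported `C²` function. -/
theorem integral_norm_gradient_sq_eq_neg {n : ℕ} {f : EuclideanSpace ℝ (Fin n) → ℝ}
    (hf : ContDiff ℝ 2 f) (hs : HasCompactSupport f) :
    ∫ x, ‖gradient f x‖ ^ 2 = -∫ x, f x * laplacianPB f x := by
  have hg (e : EuclideanSpace ℝ (Fin n)) : ContDiff ℝ 1 (fun y => fderiv ℝ f y e) :=
    (hf.fderiv_right (by norm_num)).clm_apply contDiff_const
  simp only [norm_gradient_sq_eq_sum, laplacianPB, Finset.mul_sum]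
  rw [integral_finsetSum, integral_finsetSum, ← Finset.sum_neg_distrib]
  · exact Finset.sum_congr rfl fun i _ => integral_fderiv_apply_sq_eq_neg hf hs _
  · exact fun i _ => (hf.continuous.mul (((hg _).continuous_fderiv (by norm_num)).clm_apply
      continuous_const)).integrable_of_hasCompactSupport hs.mul_right
  · intro i _
    simp only [sq]
    exact ((hg _).continuous.mul (hg _).continuous).integrable_of_hasCompactSupport
      (hs.fderiv_apply ℝ _).mul_right

/-- The Laplacian of a `C²` function is continuous. -/
theorem continuous_laplacianPB {n : ℕ} {f : EuclideanSpace ℝ (Fin n) → ℝ}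
    (hf : ContDiff ℝ 2 f) : Continuous (laplacianPB f) := by
  refine continuous_finsetSum _ fun i _ => ?_
  have hg : ContDiff ℝ 1 (fun y => fderiv ℝ f y (EuclideanSpace.single i 1)) :=
    (hf.fderiv_right (by norm_num)).clm_apply contDiff_const
  exact (hg.continuous_fderiv (by norm_num)).clm_apply continuous_const

/-- If `v` is a compactly supported `C²` function satisfying
`Δv = Ψ·v` with `Ψ ≥ -1/4`, and the Poincaré inequality holds with a constant `c < 4`,
then `v ≡ 0`. -/
theorem linearized_poissonBoltzmann_trivial_kernel {n : ℕ} (hn : 1 ≤ n)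
    (v : EuclideanSpace ℝ (Fin n) → ℝ) (hv : ContDiff ℝ 2 v)
    (hsupp : HasCompactSupport v)
    (Ψ : EuclideanSpace ℝ (Fin n) → ℝ) (hΨ : ∀ x, -(1/4 : ℝ) ≤ Ψ x)
    (heq : ∀ x, laplacianPB v x = Ψ x * v x)
    (c : ℝ) (hc0 : 0 ≤ c) (hc4 : c < 4)
    (hpoincare : (∫ x, (v x) ^ 2) ≤ c * ∫ x, ‖gradient v x‖ ^ 2) :
    ∀ x, v x = 0 := by
  have hsq : Integrable fun x => v x ^ 2 := by
    simp only [sq]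
    exact (hv.continuous.mul hv.continuous).integrable_of_hasCompactSupport hsupp.mul_right
  have henergy : ∫ x, ‖gradient v x‖ ^ 2 ≤ 1 / 4 * ∫ x, v x ^ 2 := by
    rw [integral_norm_gradient_sq_eq_neg hv hsupp, ← integral_neg, ← integral_const_mul]
    refine integral_mono ((hv.continuous.mul
      (continuous_laplacianPB hv)).integrable_of_hasCompactSupport hsupp.mul_right).neg
      (hsq.const_mul _) fun x => ?_
    simp only [heq]
    nlinarith [mul_nonneg (sq_nonneg (v x)) (neg_le_iff_add_nonneg.mp (hΨ x))]
  have hnonneg : 0 ≤ fun x => v x ^ 2 := fun x => sq_nonneg _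
  have hzero : ∫ x, v x ^ 2 = 0 := by
    have := integral_nonneg (μ := volume) hnonneg
    nlinarith [mul_le_mul_of_nonneg_left henergy hc0]
  have hae := (integral_eq_zero_iff_of_nonneg hnonneg hsq).mp hzero
  have hfun := (hv.continuous.pow 2).ae_eq_iff_eq volume continuous_zero |>.mp hae
  exact fun x => pow_eq_zero_iff two_ne_zero |>.mp (congrFun hfun x)
end

section
/- Let n ≥ 1, let Ω be a nonempty bounded open subset of EuclideanSpace ℝ n, and let u be continuous on the closure of Ω. If U is a classical solution of the Poisson–Boltzmann equation with homogeneous Dirichlet boundary conditions, then U(x) ≥ 0 for every x in the closure of Ω. -/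
open MeasureTheory Real

/-- At a local minimum, every pure second directional derivative is nonnegative. -/
theorem IsLocalMin.fderiv_fderiv_apply_nonneg {E : Type*} [NormedAddCommGroup E]
    [NormedSpace ℝ E] {f : E → ℝ} {x : E} (hmin : IsLocalMin f x) (hf : ContDiffAt ℝ 2 f x)
    (v : E) : 0 ≤ fderiv ℝ (fun y => fderiv ℝ f y v) x v := by
  set g : ℝ → ℝ := fun t => f (x + t • v) with hg
  have hline (t : ℝ) : HasDerivAt (fun t : ℝ => x + t • v) v t := by
    simpa using ((hasDerivAt_id t).smul_const v).const_add x
  have htend : Filter.Tendsto (fun t : ℝ => x + t • v) (nhds 0) (nhds x) := by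
    simpa using (hline 0).continuousAt.tendsto
  have hgmin : IsLocalMin g 0 := by
    filter_upwards [htend.eventually hmin] with t ht
    simpa [hg] using ht
  have hderiv : deriv g =ᶠ[nhds 0] fun t => fderiv ℝ f (x + t • v) v := by
    filter_upwards [htend.eventually (hf.eventually (by simp))] with t ht
    exact ((ht.differentiableAt (by simp)).hasFDerivAt.comp_hasDerivAt t (hline t)).deriv
  have hdiff : DifferentiableAt ℝ (fun y => fderiv ℝ f y v) (x + (0 : ℝ) • v) := by
    rw [zero_smul, add_zero]
    exact ((hf.fderiv_right (m := 1) (by norm_num)).differentiableAt (by simp)).clm_apply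
      (differentiableAt_const v)
  have hsecond : deriv (deriv g) 0 = fderiv ℝ (fun y => fderiv ℝ f y v) x v := by
    rw [hderiv.deriv_eq]
    simpa [Function.comp_def] using (hdiff.hasFDerivAt.comp_hasDerivAt 0 (hline 0)).deriv
  rw [← hsecond]
  by_contra! hneg
  have hgcont : ContinuousAt g 0 := by
    refine ContinuousAt.comp (g := f) ?_ (hline 0).continuousAt
    simpa using hf.continuousAt
  have hgmax : IsLocalMax g 0 :=
    isLocalMax_of_deriv_deriv_neg hneg hgmin.deriv_eq_zero hgcont
  have hconst : g =ᶠ[nhds 0] fun _ => g 0 := by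
    filter_upwards [hgmin, hgmax] with t h₁ h₂ using le_antisymm h₂ h₁
  have hzero : deriv (deriv g) 0 = 0 := by
    rw [hconst.deriv.deriv_eq]
    simp
  exact hneg.ne hzero

/-- Any classical solution of the Poisson–Boltzmann equation with
homogeneous Dirichlet boundary conditions is nonnegative on the closure of `Ω`. -/
theorem poissonBoltzmann_solution_nonneg {n : ℕ} (hn : 1 ≤ n)
    (Ω : Set (EuclideanSpace ℝ (Fin n))) (hΩne : Ω.Nonempty) (hΩo : IsOpen Ω)
    (hΩb : Bornology.IsBounded Ω)
    (u U : EuclideanSpace ℝ (Fin n) → ℝ) (hu : ContinuousOn u (closure Ω))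
    (hU : IsClassicalSolutionPB Ω u U) :
    ∀ x ∈ closure Ω, 0 ≤ U x := by
  intro x hx
  obtain ⟨z, hz, hzmin⟩ := hΩb.isCompact_closure.exists_isMinOn hΩne.closure hU.contOn
  refine le_trans ?_ (hzmin hx)
  by_cases hzΩ : z ∈ Ω
  · have hnhds : Ω ∈ nhds z := hΩo.mem_nhds hzΩ
    have hloc : IsLocalMin U z :=
      hzmin.isLocalMin (Filter.mem_of_superset hnhds subset_closure)
    have hlap : 0 ≤ laplacianPB U z := Finset.sum_nonneg fun i _ =>
      hloc.fderiv_fderiv_apply_nonneg (hU.smooth.contDiffAt hnhds) _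
    have hpos : 0 < PhiPB Ω u U z := div_pos (Real.exp_pos _) hU.intPos
    linarith [hU.eqn z hzΩ]
  · exact (hU.boundary z ⟨hz, by rwa [hΩo.interior_eq]⟩).ge
end

section
/- Let L > 0 and let v : EuclideanSpace ℝ 2 → ℝ be continuously differentiable with compact support contained in the open square (0,L) × (0,L). Then ∫ v(x)² dx ≤ (L²/(2π²)) ∫ ‖∇v(x)‖² dx, where ∇v denotes the gradient of v; that is, the Poincaré constant of the square of side L equals its area L² divided by 2π². -/
open MeasureTheory Real

section Riccati

variable {E : Type*} [NormedAddCommGroup E] [NormedSpace ℝ E]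

/-- A product is continuously differentiable as soon as one factor is, and the other one is on the
topological support of the first. -/
theorem contDiff_mul_of_tsupport {n : WithTop ℕ∞} {φ v : E → ℝ} (hv : ContDiff ℝ n v)
    (hφ : ∀ x ∈ tsupport v, ContDiffAt ℝ n φ x) : ContDiff ℝ n (fun x ↦ φ x * v x) := by
  refine contDiff_iff_contDiffAt.2 fun x ↦ ?_
  by_cases hx : x ∈ tsupport v
  · exact (hφ x hx).mul hv.contDiffAt
  · refine contDiffAt_const (c := (0 : ℝ)) |>.congr_of_eventuallyEq ?_
    filter_upwards [notMem_tsupport_iff_eventuallyEq.1 hx] with y hy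
    simp [hy]

/-- The Riccati form of Barta's inequality: if `φ` is continuously differentiable around the
support of `v` and satisfies `c ≤ -∂φ - φ²` there, where `∂` is the derivative in the direction
`e`, then `c ∫ v² ≤ ∫ (∂v)²`. -/
theorem mul_integral_sq_le_integral_fderiv_sq_of_riccati [FiniteDimensional ℝ E]
    [MeasurableSpace E] [BorelSpace E] (μ : Measure E) [μ.IsAddHaarMeasure]
    {φ v : E → ℝ} (e : E) (c : ℝ) (hv : ContDiff ℝ 1 v) (hsupp : HasCompactSupport v)
    (hφ : ∀ x ∈ tsupport v, ContDiffAt ℝ 1 φ x)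
    (hc : ∀ x ∈ tsupport v, c ≤ -fderiv ℝ φ x e - φ x ^ 2) :
    c * ∫ x, v x ^ 2 ∂μ ≤ ∫ x, fderiv ℝ v x e ^ 2 ∂μ := by
  set g : E → ℝ := fun x ↦ φ x * v x with hg_def
  have hg : ContDiff ℝ 1 g := contDiff_mul_of_tsupport hv hφ
  have hv_cont : Continuous v := hv.continuous
  have hg_cont : Continuous g := hg.continuous
  have hdv_cont : Continuous fun x ↦ fderiv ℝ v x e :=
    (hv.continuous_fderiv one_ne_zero).clm_apply continuous_const
  have hdg_cont : Continuous fun x ↦ fderiv ℝ g x e :=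
    (hg.continuous_fderiv one_ne_zero).clm_apply continuous_const
  have hg_supp : HasCompactSupport g := hsupp.mul_left
  have hdv_supp : HasCompactSupport fun x ↦ fderiv ℝ v x e := hsupp.fderiv_apply ℝ e
  have int_dvg : Integrable (fun x ↦ fderiv ℝ v x e * g x) μ :=
    (hdv_cont.mul hg_cont).integrable_of_hasCompactSupport hg_supp.mul_left
  have int_vdg : Integrable (fun x ↦ v x * fderiv ℝ g x e) μ :=
    (hv_cont.mul hdg_cont).integrable_of_hasCompactSupport hsupp.mul_right
  have int_vg : Integrable (fun x ↦ v x * g x) μ :=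
    (hv_cont.mul hg_cont).integrable_of_hasCompactSupport hsupp.mul_right
  have int_v : Integrable (fun x ↦ v x ^ 2) μ := by
    simpa only [pow_two, Pi.mul_def] using
      (hv_cont.mul hv_cont).integrable_of_hasCompactSupport hsupp.mul_right
  have int_dv : Integrable (fun x ↦ fderiv ℝ v x e ^ 2) μ := by
    simpa only [pow_two, Pi.mul_def] using
      (hdv_cont.mul hdv_cont).integrable_of_hasCompactSupport hdv_supp.mul_right
  have parts : ∫ x, v x * fderiv ℝ g x e ∂μ = -∫ x, fderiv ℝ v x e * g x ∂μ :=
    integral_mul_fderiv_eq_neg_fderiv_mul_of_integrable int_dvg int_vdg int_vg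
      (fun x _ ↦ hv.differentiable one_ne_zero x) (fun x _ ↦ hg.differentiable one_ne_zero x)
  have pointwise (x : E) :
      c * v x ^ 2 ≤ fderiv ℝ v x e ^ 2 - (fderiv ℝ v x e * g x + v x * fderiv ℝ g x e) := by
    by_cases hx : x ∈ tsupport v
    · have hdg : fderiv ℝ g x e = φ x * fderiv ℝ v x e + v x * fderiv ℝ φ x e := by
        rw [hg_def, fderiv_fun_mul ((hφ x hx).differentiableAt one_ne_zero)
          (hv.differentiable one_ne_zero x)]
        simp
      rw [hdg]
      nlinarith [mul_le_mul_of_nonneg_right (hc x hx) (sq_nonneg (v x)),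
        sq_nonneg (fderiv ℝ v x e - φ x * v x)]
    · simp only [hg_def, image_eq_zero_of_notMem_tsupport hx]
      nlinarith [sq_nonneg (fderiv ℝ v x e)]
  calc c * ∫ x, v x ^ 2 ∂μ = ∫ x, c * v x ^ 2 ∂μ := (integral_const_mul _ _).symm
    _ ≤ ∫ x, (fderiv ℝ v x e ^ 2 - (fderiv ℝ v x e * g x + v x * fderiv ℝ g x e)) ∂μ :=
      integral_mono (int_v.const_mul c) (int_dv.sub (int_dvg.add int_vdg)) pointwise
    _ = ∫ x, fderiv ℝ v x e ^ 2 ∂μ := by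
      rw [integral_sub int_dv (by exact int_dvg.add int_vdg), integral_add int_dvg int_vdg, parts]
      ring

end Riccati

/-- The sharp one-directional Poincaré inequality for functions supported in a strip of
width `L`. -/
theorem mul_integral_sq_le_integral_fderiv_single_sq {ι : Type*} [Fintype ι] [DecidableEq ι]
    (i : ι) {L : ℝ} (hL : 0 < L) {v : EuclideanSpace ℝ ι → ℝ} (hv : ContDiff ℝ 1 v)
    (hsupp : HasCompactSupport v)
    (hsub : ∀ x ∈ tsupport v, x i ∈ Set.Ioo 0 L) :
    (π / L) ^ 2 * ∫ x, v x ^ 2 ≤ ∫ x, fderiv ℝ v x (EuclideanSpace.single i 1) ^ 2 := by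
  set k : ℝ := π / L
  have sin_pos {x} (hx : x ∈ tsupport v) : 0 < sin (k * x i) := by
    obtain ⟨h0, h1⟩ := hsub x hx
    refine sin_pos_of_pos_of_lt_pi (by positivity) ?_
    calc k * x i < k * L := by gcongr
      _ = π := div_mul_cancel₀ _ hL.ne'
  refine mul_integral_sq_le_integral_fderiv_sq_of_riccati volume
    (φ := fun x ↦ k * (cos (k * x i) / sin (k * x i))) _ _ hv hsupp ?_ ?_
  · intro x hx
    have hx' := (sin_pos hx).ne'
    fun_prop (disch := assumption)
  · intro x hx
    have hx' := (sin_pos hx).ne'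
    have hlin : HasFDerivAt (fun y : EuclideanSpace ℝ ι ↦ k * y i)
        (k • (EuclideanSpace.proj i : EuclideanSpace ℝ ι →L[ℝ] ℝ)) x :=
      (EuclideanSpace.proj i : EuclideanSpace ℝ ι →L[ℝ] ℝ).hasFDerivAt.const_mul k
    have hcot : HasDerivAt (fun t ↦ k * (cos t / sin t))
        (k * ((-sin (k * x i) * sin (k * x i) - cos (k * x i) * cos (k * x i)) /
          sin (k * x i) ^ 2)) (k * x i) :=
      ((hasDerivAt_cos _).div (hasDerivAt_sin _) hx').const_mul k
    have hφ := hcot.comp_hasFDerivAt x hlin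
    simp only [Function.comp_def] at hφ
    rw [hφ.fderiv]
    apply le_of_eq
    simp
    field_simp
    ring

/-- The squared norm of the gradient is the sum of the squared partial derivatives. -/
theorem EuclideanSpace.norm_gradient_sq {ι : Type*} [Fintype ι] [DecidableEq ι]
    (v : EuclideanSpace ℝ ι → ℝ) (x : EuclideanSpace ℝ ι) :
    ‖gradient v x‖ ^ 2 = ∑ i, fderiv ℝ v x (EuclideanSpace.single i 1) ^ 2 := by
  rw [EuclideanSpace.real_norm_sq_eq]
  refine Finset.sum_congr rfl fun i _ ↦ ?_
  rw [← toDual_gradient, InnerProductSpace.toDual_apply_apply, EuclideanSpace.inner_single_right]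
  simp

/-- Poincaré inequality on the open square `(0,L) × (0,L)` in the plane:
for any `C¹` function `v` with compact support contained in the square,
`∫ v² ≤ (L²/(2π²)) ∫ ‖∇v‖²`. -/
theorem poincare_inequality_square (L : ℝ) (hL : 0 < L)
    (v : EuclideanSpace ℝ (Fin 2) → ℝ) (hv : ContDiff ℝ 1 v)
    (hsupp : HasCompactSupport v)
    (hsub : tsupport v ⊆ {x : EuclideanSpace ℝ (Fin 2) |
      x 0 ∈ Set.Ioo (0 : ℝ) L ∧ x 1 ∈ Set.Ioo (0 : ℝ) L}) :
    (∫ x, (v x) ^ 2) ≤ L ^ 2 / (2 * Real.pi ^ 2) * ∫ x, ‖gradient v x‖ ^ 2 := by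
  have integrable_sq (i : Fin 2) :
      Integrable fun x ↦ fderiv ℝ v x (EuclideanSpace.single i 1) ^ 2 := by
    have hcont : Continuous fun x ↦ fderiv ℝ v x (EuclideanSpace.single i 1) :=
      (hv.continuous_fderiv one_ne_zero).clm_apply continuous_const
    simpa only [pow_two, Pi.mul_def] using (hcont.mul hcont).integrable_of_hasCompactSupport
      (hsupp.fderiv_apply ℝ (EuclideanSpace.single i 1)).mul_right
  have h0 := mul_integral_sq_le_integral_fderiv_single_sq 0 hL hv hsupp fun x hx ↦ (hsub hx).1
  have h1 := mul_integral_sq_le_integral_fderiv_single_sq 1 hL hv hsupp fun x hx ↦ (hsub hx).2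
  simp_rw [EuclideanSpace.norm_gradient_sq, Fin.sum_univ_two]
  rw [integral_add (integrable_sq 0) (integrable_sq 1)]
  calc ∫ x, v x ^ 2
      = L ^ 2 / (2 * π ^ 2) * ((π / L) ^ 2 * (∫ x, v x ^ 2) + (π / L) ^ 2 * ∫ x, v x ^ 2) := by
        field_simp
        ring
    _ ≤ _ := by gcongr
end

section
/- Let n ≥ 1, let Ω be a nonempty bounded open subset of EuclideanSpace ℝ n, let u : EuclideanSpace ℝ n → ℝ be continuously differentiable on Ω and continuous on the closure of Ω, and let U be a classical solution of the Poisson–Boltzmann equation with homogeneous Dirichlet boundary conditions. Set ρ = Φ(U,u), E(x) = -∇U(x), E₀(x) = -∇u(x), and define f_s(y,w) = (2π)^{-n/2} ρ(y) exp(-‖w‖²/2). Then for every x ∈ Ω and every v ∈ EuclideanSpace ℝ n: (i) the stationary Vlasov equation holds, ⟨v, ∇_x f_s(x,v)⟩ + ⟨E(x) + E₀(x), ∇_v f_s(x,v)⟩ = 0, where ∇_x f_s(x,v) is the gradient of y ↦ f_s(y,v) at x and ∇_v f_s(x,v) is the gradient of w ↦ f_s(x,w) at v; and (ii) the Poisson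 equation holds, div E(x) = ρ(x), where div E = -ΔU is the divergence of E. -/
open MeasureTheory Real RealInnerProductSpace

/-- The divergence of a vector field on Euclidean space:
`div F (x) = ∑ i ∂Fᵢ/∂xᵢ (x)`. -/
noncomputable def divergencePB {n : ℕ}
    (F : EuclideanSpace ℝ (Fin n) → EuclideanSpace ℝ (Fin n))
    (x : EuclideanSpace ℝ (Fin n)) : ℝ :=
  ∑ i : Fin n, fderiv ℝ F x (EuclideanSpace.single i 1) i

/-- The coordinates of the gradient are the partial derivatives. -/
theorem gradient_apply_eq_fderiv_single {n : ℕ} (f : EuclideanSpace ℝ (Fin n) → ℝ)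
    (x : EuclideanSpace ℝ (Fin n)) (i : Fin n) :
    gradient f x i = fderiv ℝ f x (EuclideanSpace.single i 1) := by
  rw [← inner_gradient_left, EuclideanSpace.inner_single_right]
  simp

/-- The divergence of `-∇f` is `-Δf` wherever `f` is twice continuously differentiable. -/
theorem divergencePB_neg_gradient {n : ℕ} {f : EuclideanSpace ℝ (Fin n) → ℝ}
    {x : EuclideanSpace ℝ (Fin n)} (hf : ContDiffAt ℝ 2 f x) :
    divergencePB (fun y => -gradient f y) x = -laplacianPB f x := by
  have hd : DifferentiableAt ℝ (fderiv ℝ f) x :=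
    (hf.fderiv_right (m := 1) (by norm_num)).differentiableAt (by norm_num)
  have hcoord : ∀ i : Fin n, DifferentiableAt ℝ (fun y => (-gradient f y) i) x := by
    intro i
    simp only [PiLp.neg_apply, gradient_apply_eq_fderiv_single]
    exact (hd.clm_apply (differentiableAt_const _)).neg
  have hgrad : DifferentiableAt ℝ (fun y => -gradient f y) x :=
    differentiableAt_euclidean.2 hcoord
  unfold divergencePB laplacianPB
  rw [← Finset.sum_neg_distrib]
  refine Finset.sum_congr rfl fun i _ => ?_
  have h := ((EuclideanSpace.proj (𝕜 := ℝ) i).hasFDerivAt.comp x hgrad.hasFDerivAt).fderiv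
  have happly := DFunLike.congr_fun h (EuclideanSpace.single i (1 : ℝ))
  have hfun : (⇑(EuclideanSpace.proj i : EuclideanSpace ℝ (Fin n) →L[ℝ] ℝ) ∘
      fun y => -gradient f y) = fun y => -fderiv ℝ f y (EuclideanSpace.single i 1) := by
    funext y
    simp [gradient_apply_eq_fderiv_single]
  rw [hfun, fderiv_fun_neg] at happly
  simpa using happly.symm

/-- The differential of the density `Φ(W,u)`: `dΦ = -Φ (du + dW)`. -/
theorem hasFDerivAt_PhiPB {n : ℕ} (Ω : Set (EuclideanSpace ℝ (Fin n)))
    {u W : EuclideanSpace ℝ (Fin n) → ℝ} {x : EuclideanSpace ℝ (Fin n)}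
    (hu : DifferentiableAt ℝ u x) (hW : DifferentiableAt ℝ W x) :
    HasFDerivAt (PhiPB Ω u W) (-(PhiPB Ω u W x) • (fderiv ℝ u x + fderiv ℝ W x)) x := by
  have h := ((hu.hasFDerivAt.add hW.hasFDerivAt).neg.exp).mul_const
    (∫ y in Ω, Real.exp (-(u y + W y)))⁻¹
  refine h.congr_fderiv ?_
  ext w
  simp [PhiPB]
  ring

/-- The differential of the Gaussian `exp (-‖w‖² / 2)`. -/
theorem hasFDerivAt_exp_neg_norm_sq_div_two {E : Type*} [NormedAddCommGroup E]
    [InnerProductSpace ℝ E] (v : E) :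
    HasFDerivAt (fun w : E => Real.exp (-‖w‖ ^ 2 / 2))
      (-(Real.exp (-‖v‖ ^ 2 / 2)) • innerSL ℝ v) v := by
  have h := (((hasStrictFDerivAt_norm_sq v).hasFDerivAt.neg).mul_const (2 : ℝ)⁻¹).exp
  refine h.congr_fderiv ?_
  ext w
  simp [div_eq_mul_inv]

/-- A classical solution `U` of the Poisson–Boltzmann equation yields a
stationary solution of the Vlasov–Poisson system: with `ρ = Φ(U,u)`, `E = -∇U`,
`E₀ = -∇u`, and the Maxwellian `f_s(y,w) = (2π)^{-n/2} ρ(y) exp(-‖w‖²/2)`, for all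
`x ∈ Ω` and `v` we have (i) `⟨v, ∇_x f_s(x,v)⟩ + ⟨E(x)+E₀(x), ∇_v f_s(x,v)⟩ = 0`, and
(ii) `div E (x) = ρ(x)`. -/
theorem poissonBoltzmann_gives_vlasov_equilibrium {n : ℕ} (hn : 1 ≤ n)
    (Ω : Set (EuclideanSpace ℝ (Fin n))) (hΩne : Ω.Nonempty) (hΩo : IsOpen Ω)
    (hΩb : Bornology.IsBounded Ω)
    (u : EuclideanSpace ℝ (Fin n) → ℝ)
    (hu : ContinuousOn u (closure Ω)) (hu1 : ContDiffOn ℝ 1 u Ω)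
    (U : EuclideanSpace ℝ (Fin n) → ℝ) (hU : IsClassicalSolutionPB Ω u U) :
    ∀ x ∈ Ω, ∀ v : EuclideanSpace ℝ (Fin n),
      (⟪v, gradient (fun y => (2 * Real.pi) ^ (-(n : ℝ) / 2) * PhiPB Ω u U y *
              Real.exp (-‖v‖ ^ 2 / 2)) x⟫
          + ⟪(-gradient U x) + (-gradient u x),
              gradient (fun w => (2 * Real.pi) ^ (-(n : ℝ) / 2) * PhiPB Ω u U x *
                Real.exp (-‖w‖ ^ 2 / 2)) v⟫ = 0)
        ∧ divergencePB (fun y => -gradient U y) x = PhiPB Ω u U x := by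
  intro x hx v
  have hxΩ := hΩo.mem_nhds hx
  have hUx : ContDiffAt ℝ 2 U x := hU.smooth.contDiffAt hxΩ
  have hUd : DifferentiableAt ℝ U x := hUx.differentiableAt (by norm_num)
  have hud : DifferentiableAt ℝ u x := (hu1.contDiffAt hxΩ).differentiableAt (by norm_num)
  refine ⟨?_, (divergencePB_neg_gradient hUx).trans (hU.eqn x hx)⟩
  have hspace := ((hasFDerivAt_PhiPB Ω hud hUd).const_mul
    ((2 * Real.pi) ^ (-(n : ℝ) / 2))).mul_const (Real.exp (-‖v‖ ^ 2 / 2))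
  have hvel := (hasFDerivAt_exp_neg_norm_sq_div_two v).const_mul
    ((2 * Real.pi) ^ (-(n : ℝ) / 2) * PhiPB Ω u U x)
  rw [inner_gradient_right, inner_gradient_right, hspace.fderiv, hvel.fderiv]
  simp only [map_add, map_neg, smul_apply,
    add_apply, innerSL_apply_apply, inner_gradient_right, smul_eq_mul,
    conj_trivial]
  ring
end
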